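/- Consider testing the singleton Gaussian null 𝓜₀ = {N(0,1)} against the Gaussian location family 𝓜₁ = {N(μ,1) : μ ∈ ℝ}, where X₁, X₂, … are i.i.d. N(0,1), and let the Hannan–Quinn criterion with parameter c select the complex model at sample size n iff the generalized log-likelihood ratio S_n²/(2n) ≥ c log log n, where S_n = Σ_{i=1}^n X_i. If c > 1, then with probability one there are only finitely many n at which the complex model is selected; i.e., the event {S_n²/(2n) ≥ c log log n for infinitely many n} has probability zero. -/

import Mathlib

open MeasureTheory ProbabilityTheory Real Set
open scoped ENNReal BigOperators

noncomputable section

namespace SwitchPaper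

variable {𝒳 : Type*} [MeasurableSpace 𝒳]

/-- Squared Euclidean distance `‖a − b‖₂²`. -/
def sqDist {m : ℕ} (a b : Fin m → ℝ) : ℝ := ∑ j, (a j - b j) ^ 2

/-- Euclidean inner product. -/
def dot {m : ℕ} (a b : Fin m → ℝ) : ℝ := ∑ j, a j * b j

/-- A CINECSI subset of `M`: a Connected subset of the interior of `M` that is itself
Compact and has NonEmpty interior. -/
def CINECSI {m : ℕ} (M' M : Set (Fin m → ℝ)) : Prop :=
  IsConnected M' ∧ M' ⊆ interior M ∧ IsCompact M' ∧ (interior M').Nonempty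

/-- Hellinger affinity `∫ √(p q) dν = E_{p}[√(q/p)]` between two densities w.r.t. `ν`. -/
def hellingerAffinity (ν : Measure 𝒳) (p q : 𝒳 → ℝ) : ℝ := ∫ x, Real.sqrt (p x * q x) ∂ν

/-- Squared Hellinger distance `d_{H²}(p,q) = 2(1 − E_p[√(q/p)])`. -/
def dH2 (ν : Measure 𝒳) (p q : 𝒳 → ℝ) : ℝ := 2 * (1 - hellingerAffinity ν p q)

/-- Rényi divergence of order 1/2, `d_R(p,q) = −2 log E_p[√(q/p)]`; it is symmetric. -/
def dRenyiHalf (ν : Measure 𝒳) (p q : 𝒳 → ℝ) : ℝ := -2 * Real.log (hellingerAffinity ν p q)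

/-- Kullback–Leibler divergence `D(p‖q) = ∫ p log(p/q) dν` between densities w.r.t. `ν`. -/
def klDiv' (ν : Measure 𝒳) (p q : 𝒳 → ℝ) : ℝ := ∫ x, p x * Real.log (p x / q x) ∂ν

/-- `p : M → 𝒳 → ℝ` is an `m`-dimensional exponential family w.r.t. the base measure `ν`,
given in its mean-value parameterization: the densities have the exponential form
`p_μ(x) = exp(θ(μ)ᵀ φ(x) − ψ(θ(μ))) r(x)`, each `p_μ` is a probability density w.r.t. `ν`,
the mean of the sufficient statistic `φ` under `p_μ` is `μ`, the parameter set `M` is an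
open connected product of open intervals, and the representation is minimal (the components
of `φ`, together with constants, are affinely independent). -/
structure IsMeanValueExpFam {m : ℕ} (ν : Measure 𝒳) (M : Set (Fin m → ℝ))
    (p : (Fin m → ℝ) → 𝒳 → ℝ) (θ : (Fin m → ℝ) → (Fin m → ℝ))
    (φ : 𝒳 → (Fin m → ℝ)) (ψ : (Fin m → ℝ) → ℝ) (carrier : 𝒳 → ℝ) : Prop where
  carrier_pos : ∀ x, 0 < carrier x
  φ_meas : Measurable φ
  p_meas : ∀ μ, Measurable (p μ)
  M_conn : IsConnected M
  M_prod : ∃ S : Fin m → Set ℝ, (∀ j, IsOpen (S j) ∧ (S j).OrdConnected) ∧ M = Set.univ.pi S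
  p_form : ∀ μ ∈ M, ∀ x, p μ x = Real.exp (dot (θ μ) (φ x) - ψ (θ μ)) * carrier x
  p_prob : ∀ μ ∈ M, ∫ x, p μ x ∂ν = 1
  φ_int : ∀ μ ∈ M, Integrable (fun x => (∑ j, |φ x j|) * p μ x) ν
  mean_eq : ∀ μ ∈ M, ∀ i, ∫ x, φ x i * p μ x ∂ν = μ i
  minimal : ∀ c : Fin m → ℝ, ∀ d : ℝ, (∀ x, dot c (φ x) = d) → c = 0

/-- Covariance matrix of the sufficient statistic `φ` under `p_μ`. -/
def covMatrix {m : ℕ} (ν : Measure 𝒳) (p : (Fin m → ℝ) → 𝒳 → ℝ) (φ : 𝒳 → (Fin m → ℝ))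
    (μ : Fin m → ℝ) : Matrix (Fin m) (Fin m) ℝ :=
  Matrix.of fun i j => ∫ x, (φ x i - μ i) * (φ x j - μ j) * p μ x ∂ν

/-- Fisher information matrix in the mean-value parameterization: the inverse of the
covariance matrix of the sufficient statistic. -/
def fisherInfo {m : ℕ} (ν : Measure 𝒳) (p : (Fin m → ℝ) → 𝒳 → ℝ) (φ : 𝒳 → (Fin m → ℝ))
    (μ : Fin m → ℝ) : Matrix (Fin m) (Fin m) ℝ := (covMatrix ν p φ μ)⁻¹

/-- Quadratic form `vᵀ J v`. -/
def quadForm {m : ℕ} (J : Matrix (Fin m) (Fin m) ℝ) (v : Fin m → ℝ) : ℝ :=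
  ∑ i, ∑ j, v i * J i j * v j

/-- Standardized squared error (squared Mahalanobis distance)
`d_ST(a ‖ b) = (b − a)ᵀ I(a) (b − a)`, with `I` the Fisher information. -/
def dST {m : ℕ} (ν : Measure 𝒳) (p : (Fin m → ℝ) → 𝒳 → ℝ) (φ : 𝒳 → (Fin m → ℝ))
    (a b : Fin m → ℝ) : ℝ := quadForm (fisherInfo ν p φ a) (b - a)

/-- Joint density (likelihood) of an i.i.d. sample. -/
def likelihood {m : ℕ} (p : (Fin m → ℝ) → 𝒳 → ℝ) (μ : Fin m → ℝ) {n : ℕ}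
    (xs : Fin n → 𝒳) : ℝ := ∏ i, p μ (xs i)

/-- The law of `n` i.i.d. observations, each with density `f` w.r.t. `ν`. -/
def iidLaw (ν : Measure 𝒳) (f : 𝒳 → ℝ) (n : ℕ) : Measure (Fin n → 𝒳) :=
  (Measure.pi fun _ : Fin n => ν).withDensity fun xs => ENNReal.ofReal (∏ i, f (xs i))

/-- The (raw) maximum likelihood estimator of an exponential family in its mean-value
parameterization: the empirical mean of the sufficient statistic. -/
def mleRaw {m : ℕ} (φ : 𝒳 → (Fin m → ℝ)) {n : ℕ} (xs : Fin n → 𝒳) : Fin m → ℝ :=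
  fun j => (∑ i, φ (xs i) j) / n

/-- Projection `Π₀` onto the simple model: keep the first `m₀` coordinates, replace the
remaining ones by the fixed values. -/
def proj0 {m₁ : ℕ} (m₀ : ℕ) (fixed : Fin m₁ → ℝ) (μ : Fin m₁ → ℝ) : Fin m₁ → ℝ :=
  fun j => if (j : ℕ) < m₀ then μ j else fixed j

/-- The parameter set of the nested submodel `𝓜₀`: the last `m₁ − m₀` coordinates are
fixed to known values. -/
def nestedSub {m₁ : ℕ} (m₀ : ℕ) (M₁ : Set (Fin m₁ → ℝ)) (fixed : Fin m₁ → ℝ) :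
    Set (Fin m₁ → ℝ) := {μ ∈ M₁ | ∀ j : Fin m₁, m₀ ≤ (j : ℕ) → μ j = fixed j}

/-- Embedding of the `m₀`-dimensional parameter of the simple model into `ℝ^{m₁}`. -/
def embed0 {m₀ m₁ : ℕ} (h : m₀ ≤ m₁) (fixed : Fin m₁ → ℝ) (t : Fin m₀ → ℝ) : Fin m₁ → ℝ :=
  fun j => if hj : (j : ℕ) < m₀ then t ⟨(j : ℕ), hj⟩ else fixed j

/-- Bayes marginal density of a sample: `p_B(xⁿ) = ∫_M w(μ) p_μ(xⁿ) dμ`. -/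
def bayesMarginal {m : ℕ} (p : (Fin m → ℝ) → 𝒳 → ℝ) (M : Set (Fin m → ℝ))
    (w : (Fin m → ℝ) → ℝ) {n : ℕ} (xs : Fin n → 𝒳) : ℝ :=
  ∫ μ in M, w μ * likelihood p μ xs

/-- The first `k` observations of a sample of size `n ≥ k`. -/
def prefixObs {n : ℕ} (xs : Fin n → 𝒳) (k : ℕ) (h : k ≤ n) : Fin k → 𝒳 :=
  fun i => xs (Fin.castLE h i)

/-- The strategy `p̄_t` that switches from the simple to the complex model after `t − 1`
observations: `p̄_t(xⁿ) = p_{B,0}(x^{t−1}) · p_{B,1}(x_t,…,x_n | x^{t−1})`. -/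
def pBar (pB0 pB1 : (k : ℕ) → (Fin k → 𝒳) → ℝ) (t : ℕ) {n : ℕ} (xs : Fin n → 𝒳) : ℝ :=
  if h : t - 1 < n then
    pB0 (t - 1) (prefixObs xs (t - 1) h.le) * pB1 n xs / pB1 (t - 1) (prefixObs xs (t - 1) h.le)
  else pB0 n xs

/-- The switch distribution `p_{sw,1}(xⁿ) = Σ_t π(t) p̄_t(xⁿ)`. -/
def pSwitch (pB0 pB1 : (k : ℕ) → (Fin k → 𝒳) → ℝ) (pri : ℕ → ℝ) {n : ℕ} (xs : Fin n → 𝒳) : ℝ :=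
  ∑' t : ℕ, pri t * pBar pB0 pB1 t xs

/-- A prior on switching times supported on powers of two, with `π(2^i) ∝ i^{−κ}`. -/
def SwitchPrior (pri : ℕ → ℝ) (κ : ℝ) : Prop :=
  (∀ t, 0 ≤ pri t) ∧ (∑' t : ℕ, pri t = 1) ∧ (∀ t, pri t ≠ 0 → ∃ i : ℕ, t = 2 ^ i) ∧ 0 < pri 1 ∧
    ∃ c > 0, ∀ i : ℕ, 1 ≤ i → pri (2 ^ i) = c * (i : ℝ) ^ (-κ)

/-- The event (at sample size `n`) that the switch criterion selects the simple model,
i.e. `p_{sw,1}(xⁿ)/p_{B,0}(xⁿ) ≤ 1`. -/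
def swSelectsSimple (pB0 pB1 : (k : ℕ) → (Fin k → 𝒳) → ℝ) (pri : ℕ → ℝ) (n : ℕ) :
    Set (Fin n → 𝒳) := {xs | pSwitch pB0 pB1 pri xs / pB0 n xs ≤ 1}

/-- `small_b(n)`: equal to `1` for `n < b₁` and to `b₂ e^{−b₃ n}` for `n ≥ b₁`. -/
def smallFn (b₁ b₂ b₃ : ℝ) (n : ℕ) : ℝ :=
  if (n : ℝ) < b₁ then 1 else b₂ * Real.exp (-b₃ * n)

/-- Estimators `μ̆₀, μ̆₁` are sufficiently efficient (with constant `C`, on the set `M₁'`)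
w.r.t. the divergence `dgen`: for all `n` and `μ₁ ∈ M₁'`, the risks
`E_{μ₁}[dgen(μ₀, μ̆₀(Xⁿ))]` and `E_{μ₁}[dgen(μ₁, μ̆₁(Xⁿ))]` are bounded by `C/n`,
where `μ₀ = Π₀(μ₁)`. -/
def SuffEff {m₁ : ℕ} (ν : Measure 𝒳) (p : (Fin m₁ → ℝ) → 𝒳 → ℝ) (m₀ : ℕ)
    (fixed : Fin m₁ → ℝ) (M₁' : Set (Fin m₁ → ℝ))
    (dgen : (Fin m₁ → ℝ) → (Fin m₁ → ℝ) → ℝ)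
    (est0 est1 : (n : ℕ) → (Fin n → 𝒳) → (Fin m₁ → ℝ)) (C : ℝ) : Prop :=
  0 < C ∧ ∀ n : ℕ, 0 < n → ∀ μ₁ ∈ M₁',
    (∫ xs, dgen (proj0 m₀ fixed μ₁) (est0 n xs) ∂(iidLaw ν (p μ₁) n)) ≤ C / n ∧
    (∫ xs, dgen μ₁ (est1 n xs) ∂(iidLaw ν (p μ₁) n)) ≤ C / n

end SwitchPaper

namespace SwitchPaper

/-- Partial products of independent integrable random variables of mean one are a martingale for
the natural filtration. -/
theorem martingale_prod_of_iIndepFun {Ω : Type*} [MeasurableSpace Ω] {P : Measure Ω}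
    [IsProbabilityMeasure P] {Z : ℕ → Ω → ℝ} (hZ : ∀ i, StronglyMeasurable (Z i))
    (hind : iIndepFun Z P) (hint : ∀ i, Integrable (Z i) P) (hmean : ∀ i, ∫ ω, Z i ω ∂P = 1) :
    Martingale (fun n => ∏ i ∈ Finset.range (n + 1), Z i) (Filtration.natural Z hZ) P := by
  have hadp : StronglyAdapted (Filtration.natural Z hZ)
      (fun n => ∏ i ∈ Finset.range (n + 1), Z i) := fun n =>
    Finset.stronglyMeasurable_prod _ fun i hi =>
      (Filtration.stronglyAdapted_natural hZ i).mono
        ((Filtration.natural Z hZ).mono (Nat.lt_succ_iff.mp (Finset.mem_range.mp hi)))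
  have hprod : ∀ n, Integrable (∏ i ∈ Finset.range (n + 1), Z i) P := by
    intro n
    induction n with
    | zero => simpa using hint 0
    | succ n ih =>
      rw [Finset.prod_range_succ]
      exact (hind.indepFun_prod_range_succ (fun i => (hZ i).measurable) (n + 1)).integrable_mul
        ih (hint _)
  refine martingale_nat hadp hprod fun n => ?_
  have hstep : Integrable ((∏ i ∈ Finset.range (n + 1), Z i) * Z (n + 1)) P := by
    rw [← Finset.prod_range_succ]
    exact hprod (n + 1)
  have hpull := condExp_mul_of_stronglyMeasurable_left (hadp n) hstep (hint (n + 1))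
  filter_upwards [hpull, hind.condExp_natural_ae_eq_of_lt hZ (Nat.lt_succ_self n)] with ω h₁ h₂
  rw [Finset.prod_range_succ _ (n + 1), h₁, Pi.mul_apply, h₂, hmean, mul_one]

/-- Maximal inequality for partial sums of i.i.d. standard Gaussian variables. -/
theorem measure_exists_le_sum_gaussian_le {Ω : Type*} [MeasurableSpace Ω] {P : Measure Ω}
    [IsProbabilityMeasure P] {X : ℕ → Ω → ℝ} (hX : ∀ i, Measurable (X i))
    (hind : iIndepFun X P) (hlaw : ∀ i, P.map (X i) = gaussianReal 0 1)
    {a T : ℝ} (ha : 0 ≤ a) (hT : 0 < T) :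
    P {ω | ∃ n : ℕ, 0 < n ∧ (n : ℝ) ≤ T ∧ a ≤ ∑ i ∈ Finset.range n, X i ω} ≤
      ENNReal.ofReal (Real.exp (-(a ^ 2 / (2 * T)))) := by
  set l : ℝ := a / T with hl
  let Z : ℕ → Ω → ℝ := fun i ω => Real.exp (l * X i ω - l ^ 2 / 2)
  have hZm : ∀ i, StronglyMeasurable (Z i) := fun i =>
    (((hX i).const_mul l).sub_const _).exp.stronglyMeasurable
  have hZind : iIndepFun Z P :=
    hind.comp (fun _ x => Real.exp (l * x - l ^ 2 / 2)) fun _ => by fun_prop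
  have hZeq : ∀ i, Z i = fun ω => Real.exp (l * X i ω) * Real.exp (-(l ^ 2 / 2)) := fun i => by
    funext ω
    simp only [Z, ← Real.exp_add, sub_eq_add_neg]
  have hmgf : ∀ i, ∫ ω, Real.exp (l * X i ω) ∂P = Real.exp (l ^ 2 / 2) := fun i => by
    simpa [mgf] using mgf_gaussianReal (hlaw i) l
  have hZint : ∀ i, Integrable (Z i) P := fun i => by
    rw [hZeq]
    refine Integrable.mul_const ?_ _
    by_contra h
    have := hmgf i
    rw [integral_undef h] at this
    exact (Real.exp_pos _).ne this
  have hZmean : ∀ i, ∫ ω, Z i ω ∂P = 1 := fun i => by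
    rw [hZeq, integral_mul_const, hmgf, ← Real.exp_add, add_neg_cancel, Real.exp_zero]
  have hmart := martingale_prod_of_iIndepFun hZm hZind hZint hZmean
  have hprod : ∀ n ω, (∏ i ∈ Finset.range n, Z i) ω =
      Real.exp (l * ∑ i ∈ Finset.range n, X i ω - n * (l ^ 2 / 2)) := fun n ω => by
    simp [Z, Finset.prod_apply, ← Real.exp_sum, Finset.sum_sub_distrib, Finset.mul_sum]
  have hnonneg : ∀ n, 0 ≤ ∏ i ∈ Finset.range n, Z i := fun n ω => by
    rw [hprod]
    exact (Real.exp_pos _).le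
  have hmean : ∀ n, ∫ ω, (∏ i ∈ Finset.range (n + 1), Z i) ω ∂P = 1 := fun n => by
    have h := hmart.setIntegral_eq (Nat.zero_le n) MeasurableSet.univ
    rw [setIntegral_univ, setIntegral_univ] at h
    rw [← h]
    simpa using hZmean 0
  set N : ℕ := ⌊T⌋₊
  set e : NNReal := NNReal.mk (Real.exp (a ^ 2 / (2 * T))) (Real.exp_pos _).le with he
  set A := {ω | (e : ℝ) ≤ (Finset.range (N + 1)).sup' Finset.nonempty_range_add_one
    fun k => (∏ i ∈ Finset.range (k + 1), Z i) ω}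
  have hA : e * P A ≤ 1 := by
    refine (maximal_ineq hmart.submartingale (fun n => hnonneg (n + 1)) N).trans ?_
    rw [← ENNReal.ofReal_one, ← hmean N]
    exact ENNReal.ofReal_le_ofReal (setIntegral_le_integral (hmart.integrable N)
      (Filter.Eventually.of_forall (hnonneg (N + 1))))
  have hsub : {ω | ∃ n : ℕ, 0 < n ∧ (n : ℝ) ≤ T ∧ a ≤ ∑ i ∈ Finset.range n, X i ω} ⊆ A := by
    rintro ω ⟨n, hn, hnT, han⟩
    obtain ⟨k, rfl⟩ := Nat.exists_eq_succ_of_ne_zero hn.ne'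
    have hkN : k ∈ Finset.range (N + 1) :=
      Finset.mem_range.mpr ((Nat.lt_succ_self k).trans (Nat.lt_succ_of_le (Nat.le_floor hnT)))
    refine le_trans ?_ (Finset.le_sup' (fun k => (∏ i ∈ Finset.range (k + 1), Z i) ω) hkN)
    rw [hprod, he, NNReal.coe_mk, Real.exp_le_exp]
    have hl0 : 0 ≤ l := div_nonneg ha hT.le
    have h₁ : l * a ≤ l * ∑ i ∈ Finset.range (k + 1), X i ω := mul_le_mul_of_nonneg_left han hl0
    have h₂ : ((k + 1 : ℕ) : ℝ) * (l ^ 2 / 2) ≤ T * (l ^ 2 / 2) :=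
      mul_le_mul_of_nonneg_right hnT (by positivity)
    have h₃ : l * a - T * (l ^ 2 / 2) = a ^ 2 / (2 * T) := by
      rw [hl]
      field_simp
      ring
    linarith
  refine (measure_mono hsub).trans ?_
  have he' : (e : ENNReal) = ENNReal.ofReal (Real.exp (a ^ 2 / (2 * T))) :=
    (ENNReal.ofReal_eq_coe_nnreal _).symm
  rw [Real.exp_neg, ENNReal.ofReal_inv_of_pos (Real.exp_pos _), ← he']
  exact ENNReal.le_inv_iff_mul_le.mpr (by rwa [mul_comm])

/-- Two-sided maximal inequality for partial sums of i.i.d. standard Gaussian variables. -/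
theorem measure_exists_le_abs_sum_gaussian_le {Ω : Type*} [MeasurableSpace Ω] {P : Measure Ω}
    [IsProbabilityMeasure P] {X : ℕ → Ω → ℝ} (hX : ∀ i, Measurable (X i))
    (hind : iIndepFun X P) (hlaw : ∀ i, P.map (X i) = gaussianReal 0 1)
    {a T : ℝ} (ha : 0 ≤ a) (hT : 0 < T) :
    P {ω | ∃ n : ℕ, 0 < n ∧ (n : ℝ) ≤ T ∧ a ≤ |∑ i ∈ Finset.range n, X i ω|} ≤
      ENNReal.ofReal (2 * Real.exp (-(a ^ 2 / (2 * T)))) := by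
  have hneg_law : ∀ i, P.map (fun ω => -X i ω) = gaussianReal 0 1 := fun i => by
    rw [← neg_zero, ← gaussianReal_map_neg, ← hlaw i, Measure.map_map measurable_neg (hX i)]
    rfl
  have hpos := measure_exists_le_sum_gaussian_le hX hind hlaw ha hT
  have hneg := measure_exists_le_sum_gaussian_le (fun i => (hX i).neg)
    (hind.comp (fun _ x => -x) fun _ => measurable_neg) hneg_law ha hT
  rw [two_mul, ENNReal.ofReal_add (Real.exp_pos _).le (Real.exp_pos _).le]
  refine (measure_mono ?_).trans ((measure_union_le _ _).trans (add_le_add hpos hneg))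
  rintro ω ⟨n, hn, hnT, han⟩
  rcases le_abs.mp han with h | h
  · exact Or.inl ⟨n, hn, hnT, h⟩
  · exact Or.inr ⟨n, hn, hnT, by simpa [Finset.sum_neg_distrib] using h⟩

/-- The terms `exp (-p log (b k))` are summable when `p > 1`. -/
theorem summable_exp_neg_mul_log {p b : ℝ} (hp : 1 < p) (hb : 0 < b) :
    Summable fun k : ℕ => Real.exp (-(p * Real.log (k * b))) := by
  refine Summable.of_norm_bounded_eventually_nat
    ((Real.summable_nat_rpow.mpr (neg_lt_neg hp)).mul_right (b ^ (-p))) ?_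
  filter_upwards [Filter.eventually_gt_atTop 0] with k hk
  have hk' : (0 : ℝ) < k := Nat.cast_pos.mpr hk
  rw [Real.norm_of_nonneg (Real.exp_pos _).le, ← Real.mul_rpow hk'.le hb.le,
    Real.rpow_def_of_pos (mul_pos hk' hb)]
  exact (congrArg Real.exp (by ring)).le

/-- in the same Gaussian testing problem with `X₁, X₂, …` i.i.d. `N(0,1)`,
the Hannan–Quinn criterion with parameter `c > 1` (selecting the complex model iff
`S_n²/(2n) ≥ c log log n`) selects the complex model for only finitely many `n`, almost
surely: the event that it is selected infinitely often has probability zero. -/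
theorem statement_10 {Ω : Type*} [MeasurableSpace Ω] (P : Measure Ω) [IsProbabilityMeasure P]
    (X : ℕ → Ω → ℝ) (hXmeas : ∀ i, Measurable (X i))
    (hXindep : iIndepFun X P)
    (hXlaw : ∀ i, Measure.map (X i) P = gaussianReal 0 1)
    (S : ℕ → Ω → ℝ) (hS : ∀ n ω, S n ω = ∑ i ∈ Finset.range n, X i ω)
    (c : ℝ) (hc : 1 < c) :
    P {ω | {n : ℕ | c * Real.log (Real.log n) ≤ (S n ω) ^ 2 / (2 * n)}.Infinite} = 0 := by
  obtain ⟨θ, hθ, hθc⟩ := exists_between hc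
  have hθ0 : 0 < θ := one_pos.trans hθ
  have hlogθ : 0 < Real.log θ := Real.log_pos hθ
  let a : ℕ → ℝ := fun k => √(2 * c * θ ^ k * Real.log (k * Real.log θ))
  let A : ℕ → Set Ω := fun k =>
    {ω | ∃ n : ℕ, 0 < n ∧ (n : ℝ) ≤ θ ^ (k + 1) ∧ a k ≤ |∑ i ∈ Finset.range n, X i ω|}
  have hA : ∀ k, P (A k) ≤
      ENNReal.ofReal (2 * Real.exp (-(c / θ * Real.log (k * Real.log θ)))) := by
    intro k
    refine (measure_exists_le_abs_sum_gaussian_le hXmeas hXindep hXlaw (Real.sqrt_nonneg _)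
      (pow_pos hθ0 (k + 1))).trans (ENNReal.ofReal_le_ofReal ?_)
    refine mul_le_mul_of_nonneg_left (Real.exp_le_exp.mpr (neg_le_neg ?_)) zero_le_two
    have hpow : 0 < θ ^ k := pow_pos hθ0 k
    rw [le_div_iff₀ (by positivity)]
    calc c / θ * Real.log (k * Real.log θ) * (2 * θ ^ (k + 1))
        = 2 * c * θ ^ k * Real.log (k * Real.log θ) := by
          rw [pow_succ]
          field_simp
      _ ≤ a k ^ 2 := by
          rw [Real.sq_sqrt']
          exact le_max_left _ _
  have hsum : ∑' k, P (A k) ≠ ∞ := by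
    refine ne_top_of_le_ne_top ?_ (ENNReal.tsum_le_tsum hA)
    exact ((summable_exp_neg_mul_log ((one_lt_div hθ0).mpr hθc) hlogθ).mul_left
      2).tsum_ofReal_ne_top
  rw [measure_eq_zero_iff_ae_notMem]
  filter_upwards [ae_eventually_notMem hsum] with ω hev hω
  refine hω ?_
  obtain ⟨K, hK⟩ := Filter.eventually_atTop.mp
    (hev.and (((tendsto_natCast_atTop_atTop (R := ℝ)).atTop_mul_const hlogθ).eventually_ge_atTop 1))
  refine (Set.finite_lt_nat (⌈θ ^ K⌉₊)).subset fun n hn => ?_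
  by_contra hnK
  have hKn : θ ^ K ≤ n := Nat.ceil_le.mp (not_lt.mp hnK)
  have hn1 : (1 : ℝ) ≤ n := (one_le_pow₀ hθ.le).trans hKn
  have hn0 : (0 : ℝ) < n := one_pos.trans_le hn1
  obtain ⟨k, hk, hk'⟩ := exists_nat_pow_near hn1 hθ
  have hKk : K ≤ k := Nat.lt_succ_iff.mp ((pow_lt_pow_iff_right₀ hθ).mp (hKn.trans_lt hk'))
  obtain ⟨hnot, hlog⟩ := hK k hKk
  refine hnot ⟨n, Nat.cast_pos.mp hn0, hk'.le, ?_⟩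
  rw [← hS]
  refine Real.sqrt_le_iff.mpr ⟨abs_nonneg _, ?_⟩
  have hklog : k * Real.log θ ≤ Real.log n := by
    rw [← Real.log_pow]
    exact Real.log_le_log (pow_pos hθ0 k) hk
  have hloglog : Real.log (k * Real.log θ) ≤ Real.log (Real.log n) :=
    Real.log_le_log (one_pos.trans_le hlog) hklog
  have hnonneg : 0 ≤ Real.log (k * Real.log θ) := Real.log_nonneg hlog
  have hc0 : 0 < c := one_pos.trans hc
  rw [sq_abs]
  calc 2 * c * θ ^ k * Real.log (k * Real.log θ)
      ≤ 2 * c * n * Real.log (Real.log n) := by gcongr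
    _ = c * Real.log (Real.log n) * (2 * n) := by ring
    _ ≤ S n ω ^ 2 := (le_div_iff₀ (by positivity)).mp hn

end SwitchPaper
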